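/- (Sub-coercivity for H².) There exist universal constants c > 0 and C > 0 such that for every u ∈ C⁴((0,∞)) satisfying ∫ |(AHu)'|² + ∫ (AHu)²/(y²(1+y²)) + ∫ (Hu)²/(y⁴(1+|log y|)²) + ∫ u²/(y⁴(1+y⁴)(1+|log y|)²) + ∫ (u')²/(y²(1+y⁴)(1+|log y|)²) < ∞ (all integrals with respect to y dy on (0,∞)): ∫ (H²u)² ≥ c·[ ∫ (Hu)²/(y⁴(1+|log y|)²) + ∫ ((Hu)')²/(y²(1+|log y|)²) + ∫ (u''')²/(y²(1+|log y|)²) + ∫ (u'')²/(y⁴(1+|log y|)²) + ∫ (u')²/(y²(1+y⁴)(1+|log y|)²) + ∫ u²/(y⁴(1+y⁴)(1+|log y|)²) ] − C·[ ∫ (Hu)²/(1+y⁵) + ∫ (u')²/(1+y⁸) + ∫ u²/(1+y^{10}) ]. -/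

import Mathlib

open MeasureTheory Real Set

noncomputable section

/-- `Z(y) = (1-y²)/(1+y²)`. -/
def Zfun (y : ℝ) : ℝ := (1 - y ^ 2) / (1 + y ^ 2)

/-- `V(y) = (y⁴-6y²+1)/(1+y²)²`. -/
def Vfun (y : ℝ) : ℝ := (y ^ 4 - 6 * y ^ 2 + 1) / (1 + y ^ 2) ^ 2

/-- `Au = -u' + (Z/y) u`. -/
def Aop (u : ℝ → ℝ) (y : ℝ) : ℝ := -(deriv u y) + Zfun y / y * u y

/-- The linearized Hamiltonian `Hu = -u'' - u'/y + (V/y²) u`. -/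
def Hop (u : ℝ → ℝ) (y : ℝ) : ℝ :=
  -(deriv (deriv u) y) - deriv u y / y + Vfun y / y ^ 2 * u y

open Filter Topology

/-- `G` is integrable on `(0,∞)`, with integral at most `B`. -/
def IntegralLE (G : ℝ → ℝ) (B : ℝ) : Prop :=
  IntegrableOn G (Ioi 0) ∧ ∫ y in Ioi (0 : ℝ), G y ≤ B

namespace IntegralLE

lemma of_integrableOn {G : ℝ → ℝ} (h : IntegrableOn G (Ioi 0)) :
    IntegralLE G (∫ y in Ioi (0 : ℝ), G y) := ⟨h, le_rfl⟩

lemma add {G₁ G₂ : ℝ → ℝ} {B₁ B₂ : ℝ} (h₁ : IntegralLE G₁ B₁) (h₂ : IntegralLE G₂ B₂) :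
    IntegralLE (fun y => G₁ y + G₂ y) (B₁ + B₂) := by
  refine ⟨h₁.1.add h₂.1, ?_⟩
  rw [integral_add h₁.1 h₂.1]
  exact add_le_add h₁.2 h₂.2

lemma const_mul {G : ℝ → ℝ} {B c : ℝ} (hc : 0 ≤ c) (h : IntegralLE G B) :
    IntegralLE (fun y => c * G y) (c * B) := by
  refine ⟨h.1.const_mul c, ?_⟩
  rw [integral_const_mul]
  exact mul_le_mul_of_nonneg_left h.2 hc

lemma of_forall_pos {G : ℝ → ℝ} {B : ℝ} (h : ∀ δ > 0, IntegralLE G (B + δ)) :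
    IntegralLE G B :=
  ⟨(h 1 one_pos).1, le_of_forall_pos_le_add fun δ hδ => (h δ hδ).2⟩

/-- Bounds on all compact subintervals pass to `(0,∞)`. -/
lemma of_forall_Ioc {G : ℝ → ℝ} {B : ℝ} (hG : ContinuousOn G (Ioi 0))
    (hG0 : ∀ y, 0 < y → 0 ≤ G y)
    (h : ∀ a b, 0 < a → a ≤ 1 → 1 ≤ b → ∫ y in Ioc a b, G y ≤ B) : IntegralLE G B := by
  let a : ℕ → ℝ := fun n => 1 / ((n : ℝ) + 1)
  let b : ℕ → ℝ := fun n => (n : ℝ) + 1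
  have ha0 : ∀ n, 0 < a n := fun n => by positivity
  have ha1 : ∀ n, a n ≤ 1 := fun n => by
    simp only [a]; rw [div_le_one (by positivity)]; linarith [(n.cast_nonneg : (0 : ℝ) ≤ n)]
  have hb1 : ∀ n, 1 ≤ b n := fun n => by simp [b]
  have hta : Tendsto a atTop (𝓝 0) := tendsto_one_div_add_atTop_nhds_zero_nat
  have htb : Tendsto b atTop atTop := tendsto_atTop_add_const_right _ _ tendsto_natCast_atTop_atTop
  have hcov : AECover (volume.restrict (Ioi (0 : ℝ))) atTop fun n => Ioc (a n) (b n) :=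
    (aecover_Ioi_of_Ioi hta).inter (aecover_Iic htb)
  have hres : ∀ n, (volume.restrict (Ioi (0 : ℝ))).restrict (Ioc (a n) (b n))
      = volume.restrict (Ioc (a n) (b n)) := fun n =>
    Measure.restrict_restrict_of_subset fun x hx => (ha0 n).trans hx.1
  have hae : ∀ᵐ y ∂volume.restrict (Ioi (0 : ℝ)), 0 ≤ G y :=
    (ae_restrict_mem measurableSet_Ioi).mono hG0
  have hbd : ∀ n, ∫ y in Ioc (a n) (b n), G y ∂volume.restrict (Ioi (0 : ℝ)) ≤ B := fun n => by
    rw [hres]; exact h _ _ (ha0 n) (ha1 n) (hb1 n)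
  have hint : Integrable G (volume.restrict (Ioi (0 : ℝ))) := by
    refine hcov.integrable_of_integral_bounded_of_nonneg_ae B (fun n => ?_) hae
      (Eventually.of_forall hbd)
    rw [IntegrableOn, hres]
    exact ((hG.mono fun x hx => (ha0 n).trans_le hx.1).integrableOn_Icc).mono_set
      Ioc_subset_Icc_self
  exact ⟨hint, le_of_tendsto (hcov.integral_tendsto_of_countably_generated hint)
    (Eventually.of_forall hbd)⟩

/-- If `G ≤ E + F₀'` on `(0,1]` and `G ≤ E + F₁'` on `[1,∞)`, where the boundary terms at `1`
and `∞` have a favourable sign and the one at `0` is at least `-δ`, then `∫ G ≤ ∫ E + δ`. -/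
lemma of_flux {G E F₀ F₁ : ℝ → ℝ} {B δ : ℝ} (hE : IntegralLE E B)
    (hE0 : ∀ y, 0 < y → 0 ≤ E y) (hG : ContinuousOn G (Ioi 0)) (hG0 : ∀ y, 0 < y → 0 ≤ G y)
    (h₀ : ∀ y, 0 < y → y ≤ 1 → ∃ D, HasDerivAt F₀ D y ∧ G y ≤ E y + D)
    (h₁ : ∀ y, 1 ≤ y → ∃ D, HasDerivAt F₁ D y ∧ G y ≤ E y + D)
    (hzero : ∃ᶠ ε in 𝓝[>] (0 : ℝ), -δ ≤ F₀ ε) (hone : F₀ 1 ≤ F₁ 1)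
    (hinf : ∀ y, 1 ≤ y → F₁ y ≤ 0) : IntegralLE G (B + δ) := by
  have hGi : ∀ a b, 0 < a → IntegrableOn G (Icc a b) := fun a b ha =>
    (hG.mono fun x hx => ha.trans_le hx.1).integrableOn_Icc
  have hEi : ∀ a b, 0 < a → IntegrableOn E (Icc a b) := fun a b ha =>
    hE.1.mono_set fun x hx => ha.trans_le hx.1
  have key : ∀ (F : ℝ → ℝ) (a b : ℝ), 0 < a → a ≤ b →
      (∀ y ∈ Icc a b, ∃ D, HasDerivAt F D y ∧ G y ≤ E y + D) →
      ∫ y in Ioc a b, G y ≤ (∫ y in Ioc a b, E y) + F b - F a := by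
    intro F a b ha hab hF
    have hd : ∀ y ∈ Icc a b, HasDerivAt F (deriv F y) y ∧ G y ≤ E y + deriv F y := by
      intro y hy
      obtain ⟨D, hD, hle⟩ := hF y hy
      rw [hD.deriv]; exact ⟨hD, hle⟩
    have := intervalIntegral.sub_le_integral_of_hasDeriv_right_of_le (g := fun y => -F y)
      (g' := fun y => -deriv F y) (φ := fun y => E y - G y) hab
      (fun y hy => (hd y hy).1.continuousAt.continuousWithinAt.neg)
      (fun y hy => ((hd y (Ioo_subset_Icc_self hy)).1.neg).hasDerivWithinAt)
      ((hEi a b ha).sub (hGi a b ha))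
      (fun y hy => by have := (hd y (Ioo_subset_Icc_self hy)).2; linarith)
    rw [intervalIntegral.integral_of_le hab, integral_sub
      ((hEi a b ha).mono_set Ioc_subset_Icc_self) ((hGi a b ha).mono_set Ioc_subset_Icc_self)]
      at this
    linarith
  refine of_forall_Ioc hG hG0 fun a b ha ha1 hb1 => ?_
  obtain ⟨ε, hεF, hε0, hεa⟩ := (hzero.and_eventually (Ioc_mem_nhdsGT ha)).exists
  have hsplit : ∀ f : ℝ → ℝ, (∀ c d, 0 < c → IntegrableOn f (Icc c d)) →
      ∫ y in Ioc ε b, f y = (∫ y in Ioc ε 1, f y) + ∫ y in Ioc 1 b, f y := by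
    intro f hf
    rw [← Ioc_union_Ioc_eq_Ioc (hεa.trans ha1) hb1]
    exact setIntegral_union (Ioc_disjoint_Ioc_of_le le_rfl) measurableSet_Ioc
      ((hf _ _ hε0).mono_set Ioc_subset_Icc_self) ((hf _ _ one_pos).mono_set Ioc_subset_Icc_self)
  have k₀ := key F₀ ε 1 hε0 (hεa.trans ha1) fun y hy => h₀ y (hε0.trans_le hy.1) hy.2
  have k₁ := key F₁ 1 b one_pos hb1 fun y hy => h₁ y hy.1
  have hmono : ∫ y in Ioc a b, G y ≤ ∫ y in Ioc ε b, G y :=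
    setIntegral_mono_set ((hGi _ _ hε0).mono_set Ioc_subset_Icc_self)
      ((ae_restrict_mem measurableSet_Ioc).mono fun y hy => hG0 y (hε0.trans hy.1))
      (Ioc_subset_Ioc_left hεa).eventuallyLE
  have hsub : Ioc ε b ⊆ Ioi 0 := fun y hy => hε0.trans hy.1
  have hEmono : ∫ y in Ioc ε b, E y ≤ ∫ y in Ioi (0 : ℝ), E y :=
    setIntegral_mono_set hE.1 ((ae_restrict_mem measurableSet_Ioi).mono hE0)
      hsub.eventuallyLE
  have := hsplit G hGi
  have := hsplit E hEi
  have := hinf b hb1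
  have := hE.2
  linarith

lemma mono {G E : ℝ → ℝ} {B : ℝ} (hE : IntegralLE E B) (hG : ContinuousOn G (Ioi 0))
    (hG0 : ∀ y, 0 < y → 0 ≤ G y) (h : ∀ y, 0 < y → G y ≤ E y) : IntegralLE G B := by
  simpa using of_flux (F₀ := fun _ => 0) (F₁ := fun _ => 0) (δ := 0) hE
    (fun y hy => (hG0 y hy).trans (h y hy)) hG hG0
    (fun y hy _ => ⟨0, hasDerivAt_const _ _, by simpa using h y hy⟩)
    (fun y hy => ⟨0, hasDerivAt_const _ _, by simpa using h y (one_pos.trans_le hy)⟩)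
    (Frequently.of_forall fun _ => by simp) le_rfl (fun _ _ => le_rfl)

end IntegralLE

lemma frequently_mul_lt_of_integrableOn {g : ℝ → ℝ} (hg : IntegrableOn g (Ioi 0)) {δ : ℝ}
    (hδ : 0 < δ) : ∃ᶠ y in 𝓝[>] (0 : ℝ), y * g y < δ := by
  intro h
  obtain ⟨η, hη, hsub⟩ := mem_nhdsGT_iff_exists_Ioc_subset.1 h
  have hη0 : (0 : ℝ) < η := hη
  have hi : IntegrableOn (fun y : ℝ => y⁻¹) (Ioc 0 η) := by
    refine Integrable.mono' ((hg.mono_set (fun y hy => hy.1 : Ioc 0 η ⊆ Ioi 0)).const_mul δ⁻¹)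
      measurable_inv.aestronglyMeasurable
      ((ae_restrict_mem measurableSet_Ioc).mono fun y hy => ?_)
    have h1 : δ ≤ y * g y := not_lt.1 (hsub hy)
    have hy0 : 0 < y := hy.1
    rw [Real.norm_of_nonneg (by positivity), inv_mul_eq_div, inv_eq_one_div,
      div_le_div_iff₀ hy0 hδ]
    linarith
  rw [← intervalIntegrable_iff_integrableOn_Ioc_of_le hη0.le, intervalIntegrable_inv_iff] at hi
  rcases hi with hi | hi
  · exact hη0.ne hi
  · exact hi left_mem_uIcc

lemma abs_Zfun_le_one (y : ℝ) : |Zfun y| ≤ 1 := by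
  rw [Zfun, abs_div, abs_of_pos (by positivity : (0 : ℝ) < 1 + y ^ 2), div_le_one (by positivity),
    abs_le]
  constructor <;> nlinarith [sq_nonneg y]

lemma Zfun_sq_le_one (y : ℝ) : Zfun y ^ 2 ≤ 1 := (sq_le_one_iff_abs_le_one _).2 (abs_Zfun_le_one y)

lemma exists_eq_one_div {l : ℝ} (hl : 1 ≤ l) : ∃ x, l = 1 / x ∧ 0 < x ∧ x ≤ 1 :=
  ⟨1 / l, by field_simp, by positivity, (div_le_one (by positivity)).2 hl⟩

/-- Logarithmic Hardy inequality near the origin for the equation `A g = f`, in flux form. -/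
lemma hardy_A_near_zero {g f : ℝ → ℝ} {y : ℝ} (hy0 : 0 < y) (hy1 : y ≤ 1)
    (hg : HasDerivAt g (Zfun y / y * g y - f y) y) :
    ∃ D, HasDerivAt (fun x => 4 * (((x ^ 2)⁻¹ - 1) / (1 - log x) * g x ^ 2)) D y ∧
      g y ^ 2 / (y ^ 3 * (1 + |log y|) ^ 2) ≤ 8 * f y ^ 2 / y + 172 * y * g y ^ 2 + D := by
  have hlog : log y ≤ 0 := log_nonpos hy0.le hy1
  have hL : 1 ≤ 1 - log y := by linarith
  rw [abs_of_nonpos hlog, ← sub_eq_add_neg]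
  have hd := ((((hasDerivAt_pow 2 y).inv (by positivity)).sub_const 1).div
    ((hasDerivAt_log hy0.ne').const_sub 1) (by linarith : 1 - log y ≠ 0)).mul (hg.pow 2)
  have hd := hd.const_mul 4
  refine ⟨_, hd, ?_⟩
  simp only [Pi.pow_apply, Pi.inv_apply, Pi.div_apply, Nat.reduceSub, pow_one]
  generalize 1 - log y = l at *
  obtain ⟨x, rfl, hx0, hx1⟩ := exists_eq_one_div hL
  generalize g y = G
  generalize f y = F
  have hs : 1 - 3 * y ^ 2 ≤ Zfun y * (1 - y ^ 2) := by
    rw [Zfun, div_mul_eq_mul_div, le_div_iff₀ (by positivity)]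
    nlinarith [sq_nonneg (y ^ 2)]
  generalize Zfun y = Z at *
  rw [← sub_nonneg]
  have hb : 0 ≤ -8 * x * (1 - Z * (1 - y ^ 2)) + x ^ 2 - 2 * y ^ 4 * x ^ 2 + 172 * y ^ 4 := by
    nlinarith [sq_nonneg (x - 12 * y ^ 2), mul_nonneg hx0.le (sub_nonneg.2 hs),
      mul_nonneg (by positivity : 0 ≤ y ^ 4) (by nlinarith : 0 ≤ 1 - x ^ 2),
      (by positivity : 0 ≤ y ^ 4)]
  have hp : 0 ≤ 1 / y ^ 3 * (8 * (y * F - (1 - y ^ 2) * x * G / 2) ^ 2 +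
      G ^ 2 * (-8 * x * (1 - Z * (1 - y ^ 2)) + x ^ 2 - 2 * y ^ 4 * x ^ 2 + 172 * y ^ 4)) := by
    positivity
  convert hp using 1
  field_simp
  ring

/-- Hardy inequality near infinity for the equation `A g = f`, in flux form. -/
lemma hardy_A_near_infinity {k : ℕ} (hk : 2 ≤ k) {g f : ℝ → ℝ} {y : ℝ} (hy : 1 ≤ y)
    (hg : HasDerivAt g (Zfun y / y * g y - f y) y) :
    ∃ D, HasDerivAt
        (fun x => (((x ^ 2)⁻¹ - 1) * (x ^ k)⁻¹ / (1 + log x) ^ 2 * g x ^ 2)) D y ∧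
      g y ^ 2 / (y ^ (k + 1) * (1 + |log y|) ^ 2) ≤
        y * f y ^ 2 / (y ^ k * (1 + |log y|) ^ 2) + (k + 2) * g y ^ 2 / y ^ (k + 3) + D := by
  have hy0 : 0 < y := one_pos.trans_le hy
  have hlog : 0 ≤ log y := log_nonneg hy
  have hL : 1 ≤ 1 + log y := by linarith
  rw [abs_of_nonneg hlog]
  have hd := (((((hasDerivAt_pow 2 y).inv (by positivity)).sub_const 1).mul
    ((hasDerivAt_pow k y).inv (by positivity))).div
    (((hasDerivAt_log hy0.ne').const_add 1).pow 2)
    (pow_ne_zero 2 (by linarith : 1 + log y ≠ 0))).mul (hg.pow 2)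
  refine ⟨_, hd, ?_⟩
  simp only [Pi.pow_apply, Pi.inv_apply, Pi.div_apply, Pi.mul_apply, Nat.reduceSub, pow_one]
  obtain ⟨m, rfl⟩ : ∃ m, k = m + 1 := ⟨k - 1, by omega⟩
  simp only [Nat.add_sub_cancel]
  generalize 1 + log y = l at *
  obtain ⟨x, rfl, hx0, hx1⟩ := exists_eq_one_div hL
  generalize g y = G
  generalize f y = F
  have hm : (1 : ℝ) ≤ m := by exact_mod_cast (by omega : 1 ≤ m)
  obtain ⟨z, hz, hz0, hz1⟩ : ∃ z, z = (y ^ 2)⁻¹ ∧ 0 < z ∧ z ≤ 1 :=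
    ⟨_, rfl, by positivity, inv_le_one_of_one_le₀ (by nlinarith)⟩
  have hZ : Zfun y ≤ 0 := by
    rw [Zfun]
    exact div_nonpos_of_nonpos_of_nonneg (by nlinarith) (by positivity)
  generalize Zfun y = Z at *
  rw [← sub_nonneg]
  have hb : 0 ≤ ((m + 1) * (1 - z) - 2 * z) * x ^ 2 + 2 * (1 - z) * x ^ 3
      + 2 * (1 - z) * x ^ 2 * (-Z) - (1 - z) ^ 2 * x ^ 2 - x ^ 2 + (m + 3) * z := by
    have h1 : 0 ≤ 2 * (1 - z) * x ^ 3 := by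
      have : 0 ≤ 1 - z := by linarith
      positivity
    have h2 : 0 ≤ 2 * (1 - z) * x ^ 2 * (-Z) := by
      have : 0 ≤ 1 - z := by linarith
      have : 0 ≤ -Z := by linarith
      positivity
    have h3 : 0 ≤ (m + 3) * z * (1 - x ^ 2) := by
      have : 0 ≤ 1 - x ^ 2 := by nlinarith
      positivity
    have h4 : 0 ≤ x ^ 2 * (m - 1 + (1 - (1 - z) ^ 2)) := by
      have : 0 ≤ m - 1 + (1 - (1 - z) ^ 2) := by nlinarith
      positivity
    linarith
  have hp : 0 ≤ 1 / y ^ (m + 2) * (x ^ 2 * (y * F + (1 - z) * G) ^ 2 +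
      G ^ 2 * (((m + 1) * (1 - z) - 2 * z) * x ^ 2 + 2 * (1 - z) * x ^ 3
      + 2 * (1 - z) * x ^ 2 * (-Z) - (1 - z) ^ 2 * x ^ 2 - x ^ 2 + (m + 3) * z)) := by
    positivity
  convert hp using 1
  subst hz
  field_simp
  push_cast
  ring

/-- Logarithmic Hardy inequality near infinity, in flux form. -/
lemma hardy_log_near_infinity {g : ℝ → ℝ} {g' y : ℝ} (hy : 1 ≤ y) (hg : HasDerivAt g g' y) :
    ∃ D, HasDerivAt (fun x => 2 * (((x ^ 2)⁻¹ - 1) / (1 + log x) * g x ^ 2)) D y ∧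
      g y ^ 2 / (y * (1 + |log y|) ^ 2) ≤ 4 * y * g' ^ 2 + 5 * g y ^ 2 / y ^ 3 + D := by
  have hy0 : 0 < y := one_pos.trans_le hy
  have hlog : 0 ≤ log y := log_nonneg hy
  have hL : 1 ≤ 1 + log y := by linarith
  rw [abs_of_nonneg hlog]
  have hd := (((((hasDerivAt_pow 2 y).inv (by positivity)).sub_const 1).div
    ((hasDerivAt_log hy0.ne').const_add 1) (by positivity)).mul (hg.pow 2)).const_mul 2
  refine ⟨_, hd, ?_⟩
  simp only [Pi.pow_apply, Pi.inv_apply, Pi.div_apply, Nat.reduceSub, pow_one]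
  generalize 1 + log y = l at *
  obtain ⟨x, rfl, hx0, hx1⟩ := exists_eq_one_div hL
  generalize g y = G
  obtain ⟨z, hz, hz0, hz1⟩ : ∃ z, z = (y ^ 2)⁻¹ ∧ 0 < z ∧ z ≤ 1 :=
    ⟨_, rfl, by positivity, inv_le_one_of_one_le₀ (by nlinarith)⟩
  rw [← sub_nonneg]
  have hb : 0 ≤ 5 * z - z ^ 2 * x ^ 2 - 4 * z * x := by
    have : 0 ≤ z * (5 - z * x ^ 2 - 4 * x) :=
      mul_nonneg hz0.le (by nlinarith [mul_nonneg hz0.le hx0.le])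
    linarith
  have hp : 0 ≤ 1 / y * ((2 * (y * g') - (1 - z) * x * G) ^ 2 +
      G ^ 2 * (5 * z - z ^ 2 * x ^ 2 - 4 * z * x)) := by
    positivity
  convert hp using 1
  subst hz
  field_simp
  ring

/-- Hardy inequality near the origin for the equation `A* p = w`, in flux form. -/
lemma hardy_adjoint_near_zero {p w : ℝ → ℝ} {y : ℝ} (hy0 : 0 < y) (hy1 : y ≤ 1)
    (hp : HasDerivAt p (w y - 2 / (y * (1 + y ^ 2)) * p y) y) :
    ∃ D, HasDerivAt (fun x => -((x ^ 4)⁻¹ / (1 - log x) ^ 2 * p x ^ 2)) D y ∧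
      p y ^ 2 / (y ^ 5 * (1 + |log y|) ^ 2) ≤ w y ^ 2 / (y ^ 3 * (1 + |log y|) ^ 2) + D := by
  have hlog : log y ≤ 0 := log_nonpos hy0.le hy1
  have hL : 1 ≤ 1 - log y := by linarith
  rw [abs_of_nonpos hlog, ← sub_eq_add_neg]
  have hd := ((((hasDerivAt_pow 4 y).inv (by positivity)).div
    (((hasDerivAt_log hy0.ne').const_sub 1).pow 2)
    (pow_ne_zero 2 (by linarith : 1 - log y ≠ 0))).mul (hp.pow 2)).neg
  refine ⟨_, hd, ?_⟩
  simp only [Pi.pow_apply, Pi.inv_apply, Pi.div_apply, Nat.reduceSub, pow_one]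
  generalize 1 - log y = l at *
  obtain ⟨x, rfl, hx0, hx1⟩ := exists_eq_one_div hL
  generalize p y = P
  generalize w y = W
  rw [← sub_nonneg]
  have hp : 0 ≤ 1 / y ^ 5 * x ^ 2 * ((y * W - P) ^ 2 +
      2 * P ^ 2 * ((1 - x) + 2 / (1 + y ^ 2))) := by
    have : 0 ≤ 1 - x := by linarith
    positivity
  convert hp using 1
  field_simp
  ring

/-- Hardy inequality near infinity for the equation `A* p = w`, in flux form. -/
lemma hardy_adjoint_near_infinity {p w : ℝ → ℝ} {y : ℝ} (hy : 1 ≤ y)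
    (hp : HasDerivAt p (w y - 2 / (y * (1 + y ^ 2)) * p y) y) :
    ∃ D, HasDerivAt (fun x => -((x ^ 4)⁻¹ / (1 + log x) ^ 2 * p x ^ 2)) D y ∧
      p y ^ 2 / (y ^ 5 * (1 + |log y|) ^ 2) ≤ w y ^ 2 / (y ^ 3 * (1 + |log y|) ^ 2) + D := by
  have hy0 : 0 < y := one_pos.trans_le hy
  have hlog : 0 ≤ log y := log_nonneg hy
  have hL : 1 ≤ 1 + log y := by linarith
  rw [abs_of_nonneg hlog]
  have hd := ((((hasDerivAt_pow 4 y).inv (by positivity)).div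
    (((hasDerivAt_log hy0.ne').const_add 1).pow 2)
    (pow_ne_zero 2 (by linarith : 1 + log y ≠ 0))).mul (hp.pow 2)).neg
  refine ⟨_, hd, ?_⟩
  simp only [Pi.pow_apply, Pi.inv_apply, Pi.div_apply, Nat.reduceSub, pow_one]
  generalize 1 + log y = l at *
  obtain ⟨x, rfl, hx0, -⟩ := exists_eq_one_div hL
  generalize p y = P
  generalize w y = W
  rw [← sub_nonneg]
  have hp : 0 ≤ 1 / y ^ 5 * x ^ 2 * ((y * W - P) ^ 2 +
      2 * P ^ 2 * (1 + x + 2 / (1 + y ^ 2))) := by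
    positivity
  convert hp using 1
  field_simp
  ring

lemma mul_logWeight_mono {s y : ℝ} (hs : 0 < s) (hsy : s ≤ y) (hy : y ≤ 1) :
    s * (1 + |log s|) ≤ y * (1 + |log y|) := by
  have hy0 : 0 < y := hs.trans_le hsy
  have hly := log_nonpos hy0.le hy
  rw [abs_of_nonpos hly, abs_of_nonpos (log_nonpos hs.le (hsy.trans hy))]
  have h1 : log y - log s ≤ y / s - 1 := by
    rw [← log_div hy0.ne' hs.ne']
    exact log_le_sub_one_of_pos (by positivity)
  have h2 : s * (log y - log s) ≤ y - s :=
    (mul_le_mul_of_nonneg_left h1 hs.le).trans (by field_simp; rfl)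
  nlinarith [mul_nonneg (sub_nonneg.2 hsy) (neg_nonneg.2 hly)]

lemma mul_logWeight_le_one {y : ℝ} (hy0 : 0 < y) (hy1 : y ≤ 1) : y * (1 + |log y|) ≤ 1 := by
  simpa using mul_logWeight_mono hy0 hy1 le_rfl

lemma logWeight_sq_le {y : ℝ} (hy : 1 ≤ y) : (1 + |log y|) ^ 2 ≤ 4 * y := by
  have hy0 : 0 < y := one_pos.trans_le hy
  have hs := sqrt_pos.2 hy0
  rw [abs_of_nonneg (log_nonneg hy)]
  have h1 : log y ≤ 2 * (√y - 1) := by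
    have := log_le_sub_one_of_pos hs
    rw [log_sqrt hy0.le] at this
    linarith
  have h2 := log_nonneg hy
  nlinarith [sq_sqrt hy0.le]

lemma pow_mul_logWeight_sq_le {y : ℝ} (hy : 0 < y) (k : ℕ) :
    y ^ (k + 2) * (1 + |log y|) ^ 2 ≤ 4 * (1 + y ^ (k + 3)) := by
  rcases le_total y 1 with h | h
  · have h1 : (y * (1 + |log y|)) ^ 2 ≤ 1 :=
      pow_le_one₀ (by positivity) (mul_logWeight_le_one hy h)
    have h2 : y ^ k * (y * (1 + |log y|)) ^ 2 ≤ 1 :=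
      mul_le_one₀ (pow_le_one₀ hy.le h) (by positivity) h1
    calc y ^ (k + 2) * (1 + |log y|) ^ 2 = y ^ k * (y * (1 + |log y|)) ^ 2 := by ring
      _ ≤ 1 := h2
      _ ≤ 4 * (1 + y ^ (k + 3)) := by nlinarith [pow_pos hy (k + 3)]
  · calc y ^ (k + 2) * (1 + |log y|) ^ 2 ≤ y ^ (k + 2) * (4 * y) := by
          gcongr; exact logWeight_sq_le h
      _ = 4 * y ^ (k + 3) := by ring
      _ ≤ 4 * (1 + y ^ (k + 3)) := by linarith

lemma div_mul_le_const_mul {a b c t y : ℝ} (ht : 0 ≤ t) (hy : 0 < y) (ha : 0 < a) (hb : 0 < b)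
    (h : a ≤ c * b) : t / b * y ≤ c * (t / a * y) := by
  have h' : t / b ≤ c * (t / a) := by
    rw [← mul_div_assoc, div_le_div_iff₀ hb ha]
    nlinarith [mul_le_mul_of_nonneg_left h ht]
  calc t / b * y ≤ c * (t / a) * y := mul_le_mul_of_nonneg_right h' hy.le
    _ = c * (t / a * y) := by ring

lemma continuousOn_logWeight : ContinuousOn (fun y => 1 + |log y|) (Ioi 0) :=
  continuousOn_const.add (continuousOn_log.mono fun _ hy => (ne_of_gt hy)).abs

/-- Global weighted bound for the solution `g` of `A g = f`. -/
lemma integralLE_of_A {k : ℕ} (hk : 2 ≤ k) {g f G E : ℝ → ℝ} {B : ℝ} (hE : IntegralLE E B)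
    (hE0 : ∀ y, 0 < y → 0 ≤ E y) (hG : ContinuousOn G (Ioi 0)) (hG0 : ∀ y, 0 < y → 0 ≤ G y)
    (hg : ∀ y, 0 < y → HasDerivAt g (Zfun y / y * g y - f y) y)
    (hG₀ : ∀ y, 0 < y → y ≤ 1 → G y ≤ g y ^ 2 / (y ^ 3 * (1 + |log y|) ^ 2))
    (hG₁ : ∀ y, 1 ≤ y → G y ≤ g y ^ 2 / (y ^ (k + 1) * (1 + |log y|) ^ 2))
    (hE₀ : ∀ y, 0 < y → y ≤ 1 → 8 * f y ^ 2 / y + 172 * y * g y ^ 2 ≤ E y)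
    (hE₁ : ∀ y, 1 ≤ y → y * f y ^ 2 / (y ^ k * (1 + |log y|) ^ 2)
      + (k + 2) * g y ^ 2 / y ^ (k + 3) ≤ E y) : IntegralLE G B := by
  refine add_zero B ▸ IntegralLE.of_flux hE hE0 hG hG0
    (F₀ := fun x => 4 * (((x ^ 2)⁻¹ - 1) / (1 - log x) * g x ^ 2))
    (F₁ := fun x => ((x ^ 2)⁻¹ - 1) * (x ^ k)⁻¹ / (1 + log x) ^ 2 * g x ^ 2)
    (fun y hy0 hy1 => ?_) (fun y hy => ?_) ?_ (by simp) (fun y hy => ?_)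
  · obtain ⟨D, hD, h⟩ := hardy_A_near_zero hy0 hy1 (hg y hy0)
    exact ⟨D, hD, by linarith [hG₀ y hy0 hy1, hE₀ y hy0 hy1]⟩
  · obtain ⟨D, hD, h⟩ := hardy_A_near_infinity hk hy (hg y (one_pos.trans_le hy))
    exact ⟨D, hD, by linarith [hG₁ y hy, hE₁ y hy]⟩
  · refine Eventually.frequently ?_
    filter_upwards [Ioc_mem_nhdsGT one_pos] with y hy
    have h1 : 0 ≤ (y ^ 2)⁻¹ - 1 :=
      sub_nonneg.2 ((one_le_inv₀ (by have := hy.1; positivity)).2 (pow_le_one₀ hy.1.le hy.2))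
    have h2 : 0 ≤ 1 - log y := by linarith [log_nonpos hy.1.le hy.2]
    rw [neg_zero]
    positivity
  · have h1 : (y ^ 2)⁻¹ - 1 ≤ 0 := sub_nonpos.2 (inv_le_one_of_one_le₀ (one_le_pow₀ hy))
    have h2 : 0 ≤ (y ^ k)⁻¹ / (1 + log y) ^ 2 * g y ^ 2 := by
      have : 0 < y := one_pos.trans_le hy
      positivity
    calc _ = ((y ^ 2)⁻¹ - 1) * ((y ^ k)⁻¹ / (1 + log y) ^ 2 * g y ^ 2) := by ring
      _ ≤ 0 := mul_nonpos_of_nonpos_of_nonneg h1 h2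

/-- Pointwise decay at the origin of the solution `p` of `A* p = w` which is not singular there. -/
lemma sq_div_le_of_adjoint {p w g : ℝ → ℝ} {B : ℝ}
    (hW : IntegralLE (fun y => w y ^ 2 / (y ^ 3 * (1 + |log y|) ^ 2)) B)
    (hp : ∀ y, 0 < y → HasDerivAt p (w y - 2 / (y * (1 + y ^ 2)) * p y) y)
    (hg : IntegrableOn g (Ioi 0))
    (hpg : ∀ y, 0 < y → p y ^ 2 / ((1 + y ^ 4) * (1 + |log y|) ^ 2) ≤ y * g y)
    {y : ℝ} (hy0 : 0 < y) (hy1 : y ≤ 1) :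
    p y ^ 2 / (y ^ 4 * (1 + |log y|) ^ 2) ≤ 4 * B := by
  let h : ℝ → ℝ := fun s => s ^ 3 / (1 + s ^ 2) ^ 2 * p s ^ 2
  have hd : ∀ s, 0 < s → ∃ D, HasDerivAt h D s ∧ D ≤ s ^ 4 * w s ^ 2 := by
    intro s hs
    have hd := ((hasDerivAt_pow 3 s).div (((hasDerivAt_pow 2 s).const_add 1).pow 2)
      (by simp only [Pi.pow_apply]; positivity)).mul ((hp s hs).pow 2)
    refine ⟨_, hd, ?_⟩
    simp only [Pi.pow_apply, Pi.div_apply]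
    rw [← sub_nonneg]
    have : 0 ≤ s ^ 4 * w s ^ 2 * (1 - 1 / (1 + s ^ 2) ^ 2)
        + 1 / (1 + s ^ 2) ^ 2 * (s ^ 2 * w s - s * p s) ^ 2 := by
      have : 0 ≤ 1 - 1 / (1 + s ^ 2) ^ 2 :=
        sub_nonneg.2 ((div_le_one (by positivity)).2 (one_le_pow₀ (by nlinarith [sq_nonneg s])))
      positivity
    convert this using 1
    field_simp
    push_cast
    ring
  have hdh : ∀ s, 0 < s → HasDerivAt h (deriv h s) s ∧ deriv h s ≤ s ^ 4 * w s ^ 2 := by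
    intro s hs
    obtain ⟨D, hD, hle⟩ := hd s hs
    rw [hD.deriv]; exact ⟨hD, hle⟩
  set K := y ^ 7 * (1 + |log y|) ^ 2 with hK
  have hK0 : 0 < K := by positivity
  have hbound : h y ≤ K * B := by
    refine le_of_forall_pos_le_add fun δ hδ => ?_
    obtain ⟨ε, hε, hε0, hεy⟩ :=
      ((frequently_mul_lt_of_integrableOn hg hδ).and_eventually (Ioc_mem_nhdsGT hy0)).exists
    have hint : IntegrableOn (fun s => K * (w s ^ 2 / (s ^ 3 * (1 + |log s|) ^ 2))) (Icc ε y) :=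
      IntegrableOn.mono_set (hW.1.const_mul K) fun s hs => hε0.trans_le hs.1
    have h1 := intervalIntegral.sub_le_integral_of_hasDeriv_right_of_le (g := h) (g' := deriv h)
      hεy (fun s hs => (hdh s (hε0.trans_le hs.1)).1.continuousAt.continuousWithinAt)
      (fun s hs => (hdh s (hε0.trans hs.1)).1.hasDerivWithinAt) hint (fun s hs => by
        have hs0 : 0 < s := hε0.trans hs.1
        refine (hdh s hs0).2.trans ?_
        have hm := mul_logWeight_mono hs0 hs.2.le hy1
        have h7 : s ^ 7 * (1 + |log s|) ^ 2 ≤ K := by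
          calc s ^ 7 * (1 + |log s|) ^ 2 = s ^ 5 * (s * (1 + |log s|)) ^ 2 := by ring
            _ ≤ y ^ 5 * (y * (1 + |log y|)) ^ 2 := by
              have := hs.2.le
              gcongr
            _ = K := by ring
        calc s ^ 4 * w s ^ 2 = s ^ 7 * (1 + |log s|) ^ 2 *
              (w s ^ 2 / (s ^ 3 * (1 + |log s|) ^ 2)) := by field_simp
          _ ≤ _ := by gcongr)
    rw [intervalIntegral.integral_of_le hεy, integral_const_mul] at h1
    have h2 : ∫ s in Ioc ε y, w s ^ 2 / (s ^ 3 * (1 + |log s|) ^ 2) ≤ B :=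
      (setIntegral_mono_set hW.1 ((ae_restrict_mem measurableSet_Ioi).mono fun s hs => by
        have : (0 : ℝ) < s := hs
        positivity) (show Ioc ε y ⊆ Ioi 0 from fun s hs => hε0.trans hs.1).eventuallyLE).trans hW.2
    have h3 : h ε ≤ ε * g ε := by
      refine le_trans ?_ (hpg ε hε0)
      have ha : (ε * (1 + |log ε|)) ^ 2 ≤ 1 :=
        pow_le_one₀ (by positivity) (mul_logWeight_le_one hε0 (hεy.trans hy1))
      have hb : ε ^ 3 * ((1 + ε ^ 4) * (1 + |log ε|) ^ 2) ≤ (1 + ε ^ 2) ^ 2 := by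
        have hε1 : ε ≤ 1 := hεy.trans hy1
        have : ε * (ε * (1 + |log ε|)) ^ 2 ≤ 1 := mul_le_one₀ hε1 (by positivity) ha
        calc ε ^ 3 * ((1 + ε ^ 4) * (1 + |log ε|) ^ 2)
            = (1 + ε ^ 4) * (ε * (ε * (1 + |log ε|)) ^ 2) := by ring
          _ ≤ (1 + ε ^ 4) * 1 := by gcongr
          _ ≤ (1 + ε ^ 2) ^ 2 := by nlinarith [sq_nonneg ε]
      simp only [h]
      rw [div_mul_eq_mul_div, div_le_div_iff₀ (by positivity) (by positivity)]
      nlinarith [mul_le_mul_of_nonneg_left hb (sq_nonneg (p ε))]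
    nlinarith [mul_le_mul_of_nonneg_left h2 hK0.le]
  have hy2 : (1 + y ^ 2) ^ 2 ≤ 4 := by nlinarith [pow_le_one₀ hy0.le hy1 (n := 2), sq_nonneg y]
  calc p y ^ 2 / (y ^ 4 * (1 + |log y|) ^ 2) = (1 + y ^ 2) ^ 2 * (h y / K) := by
        simp only [h, hK]; field_simp
    _ ≤ 4 * (h y / K) := by
        have : 0 ≤ h y := by positivity
        gcongr
    _ ≤ 4 * B := by
        gcongr
        rw [div_le_iff₀ hK0]
        linarith

/-- Global weighted bound for the solution `p` of `A* p = w` which is not singular at `0`. -/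
lemma integralLE_of_adjoint {p w g : ℝ → ℝ} {B : ℝ}
    (hW : IntegralLE (fun y => w y ^ 2 / (y ^ 3 * (1 + |log y|) ^ 2)) B)
    (hp : ∀ y, 0 < y → HasDerivAt p (w y - 2 / (y * (1 + y ^ 2)) * p y) y)
    (hg : IntegrableOn g (Ioi 0))
    (hpg : ∀ y, 0 < y → p y ^ 2 / ((1 + y ^ 4) * (1 + |log y|) ^ 2) ≤ y * g y) :
    IntegralLE (fun y => p y ^ 2 / (y ^ 5 * (1 + |log y|) ^ 2)) (B + 4 * B) := by
  have hpc : ContinuousOn p (Ioi 0) := fun y hy => (hp y hy).continuousAt.continuousWithinAt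
  refine IntegralLE.of_flux hW (fun y hy => by positivity) ?_ (fun y hy => by positivity)
    (F₀ := fun x => -((x ^ 4)⁻¹ / (1 - log x) ^ 2 * p x ^ 2))
    (F₁ := fun x => -((x ^ 4)⁻¹ / (1 + log x) ^ 2 * p x ^ 2))
    (fun y hy0 hy1 => hardy_adjoint_near_zero hy0 hy1 (hp y hy0))
    (fun y hy => hardy_adjoint_near_infinity hy (hp y (one_pos.trans_le hy))) ?_ (by simp)
    (fun y hy => ?_)
  · exact (hpc.pow 2).div ((continuousOn_id.pow 5).mul (continuousOn_logWeight.pow 2))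
      fun y hy => by
        have : (0 : ℝ) < y := hy
        change y ^ 5 * (1 + |log y|) ^ 2 ≠ 0
        positivity
  · refine Eventually.frequently ?_
    filter_upwards [Ioc_mem_nhdsGT one_pos] with y hy
    have := sq_div_le_of_adjoint hW hp hg hpg hy.1 hy.2
    rw [abs_of_nonpos (log_nonpos hy.1.le hy.2), ← sub_eq_add_neg] at this
    rw [neg_le_neg_iff]
    refine le_of_eq_of_le ?_ this
    rw [div_mul_eq_mul_div, inv_mul_eq_div, div_div]
  · have : 0 < y := one_pos.trans_le hy
    rw [neg_nonpos]
    positivity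

lemma hasDerivAt_deriv_of_contDiffOn {n : ℕ} {g : ℝ → ℝ} (hg : ContDiffOn ℝ (n + 1) g (Ioi 0))
    {y : ℝ} (hy : 0 < y) : HasDerivAt g (deriv g y) y :=
  ((hg.differentiableOn (by simp)).differentiableAt (Ioi_mem_nhds hy)).hasDerivAt

lemma hasDerivAt_eq_Aop {n : ℕ} {g : ℝ → ℝ} (hg : ContDiffOn ℝ (n + 1) g (Ioi 0)) {y : ℝ}
    (hy : 0 < y) : HasDerivAt g (Zfun y / y * g y - Aop g y) y := by
  convert hasDerivAt_deriv_of_contDiffOn hg hy using 1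
  rw [Aop]
  ring

lemma contDiffOn_deriv {n : ℕ} {g : ℝ → ℝ} (hg : ContDiffOn ℝ (n + 1) g (Ioi 0)) :
    ContDiffOn ℝ n (deriv g) (Ioi 0) :=
  hg.deriv_of_isOpen isOpen_Ioi le_rfl

lemma contDiffOn_Aop {n : ℕ} {g : ℝ → ℝ} (hg : ContDiffOn ℝ (n + 1) g (Ioi 0)) :
    ContDiffOn ℝ n (Aop g) (Ioi 0) := by
  have h0 : ContDiffOn ℝ n g (Ioi 0) := hg.of_le (by norm_cast; omega)
  have hZ : ContDiffOn ℝ n (fun y => Zfun y / y) (Ioi 0) := by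
    simp only [Zfun]
    exact (ContDiffOn.div (by fun_prop) (by fun_prop) fun y _ => by positivity).div contDiffOn_id
      fun y hy => ne_of_gt hy
  exact (contDiffOn_deriv hg).neg.add (hZ.mul h0)

lemma contDiffOn_Hop {n : ℕ} {g : ℝ → ℝ} (hg : ContDiffOn ℝ (n + 2) g (Ioi 0)) :
    ContDiffOn ℝ n (Hop g) (Ioi 0) := by
  have hg' : ContDiffOn ℝ ((n + 1 : ℕ) + 1) g (Ioi 0) := by
    convert hg using 1; push_cast; rw [add_assoc]; rfl
  have h0 : ContDiffOn ℝ n g (Ioi 0) := hg'.of_le (by norm_cast; omega)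
  have h1 := contDiffOn_deriv hg'
  have h2 : ContDiffOn ℝ n (deriv (deriv g)) (Ioi 0) := contDiffOn_deriv h1
  have hV : ContDiffOn ℝ n (fun y => Vfun y / y ^ 2) (Ioi 0) := by
    simp only [Vfun]
    exact (ContDiffOn.div (by fun_prop) (by fun_prop) fun y _ => by positivity).div
      (by fun_prop) fun y hy => pow_ne_zero 2 (ne_of_gt hy)
  exact (h2.neg.sub ((h1.of_le (by norm_cast; omega)).div contDiffOn_id
    fun y hy => ne_of_gt hy)).add (hV.mul h0)

/-- The factorization `H = A* A`, with `A* p = p' + (1 + Z) p / y`. -/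
lemma hasDerivAt_Aop {g : ℝ → ℝ} (hg : ContDiffOn ℝ 2 g (Ioi 0)) {y : ℝ} (hy : 0 < y) :
    HasDerivAt (Aop g) (Hop g y - 2 / (y * (1 + y ^ 2)) * Aop g y) y := by
  have hg' : ContDiffOn ℝ ((1 : ℕ) + 1) g (Ioi 0) := by convert hg using 1; norm_num
  have hd1 := hasDerivAt_deriv_of_contDiffOn (n := 0) (by simpa using contDiffOn_deriv hg') hy
  have hd0 := hasDerivAt_deriv_of_contDiffOn hg' hy
  have hZ := (((hasDerivAt_pow 2 y).const_sub 1).div ((hasDerivAt_pow 2 y).const_add 1)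
    (by positivity)).div (hasDerivAt_id y) hy.ne'
  refine HasDerivAt.congr_deriv (f := Aop g) (hd1.neg.add (hZ.mul hd0)) ?_
  simp only [Hop, Aop, Vfun, Zfun, id, Pi.div_apply]
  field_simp
  push_cast
  ring

/-- The identity `∫ (A* v)² = ∫ v'² + 4 ∫ v² / (y² (1 + y²))` for `v = A w`, as an inequality. -/
lemma integralLE_energy {w : ℝ → ℝ} (hw : ContDiffOn ℝ 2 w (Ioi 0))
    (hv' : IntegrableOn (fun y => (deriv (Aop w) y) ^ 2 * y) (Ioi 0))
    (hv : IntegrableOn (fun y => (Aop w y) ^ 2 / (y ^ 2 * (1 + y ^ 2)) * y) (Ioi 0)) :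
    IntegralLE (fun y => deriv (Aop w) y ^ 2 * y + 4 * (Aop w y ^ 2 / (y ^ 2 * (1 + y ^ 2)) * y))
      (∫ y in Ioi (0 : ℝ), Hop w y ^ 2 * y) := by
  have hw2 : ContDiffOn ℝ ((1 : ℕ) + 1) w (Ioi 0) := by convert hw using 1; norm_num
  have hvd : ∀ y, 0 < y → HasDerivAt (Aop w) (deriv (Aop w) y) y := fun y hy =>
    (hasDerivAt_Aop hw hy).differentiableAt.hasDerivAt
  have hHv : ∀ y, 0 < y → Hop w y = deriv (Aop w) y + 2 / (y * (1 + y ^ 2)) * Aop w y :=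
    fun y hy => by rw [(hasDerivAt_Aop hw hy).deriv]; ring
  have hHc : ContinuousOn (Hop w) (Ioi 0) :=
    (contDiffOn_Hop (n := 0) (by simpa using hw)).continuousOn
  have hvc : ContinuousOn (Aop w) (Ioi 0) := (contDiffOn_Aop hw2).continuousOn
  have hv'c : ContinuousOn (deriv (Aop w)) (Ioi 0) :=
    (contDiffOn_deriv (n := 0) (by simpa using contDiffOn_Aop hw2)).continuousOn
  have hH : IntegrableOn (fun y => Hop w y ^ 2 * y) (Ioi 0) := by
    refine (IntegralLE.mono (G := fun y => Hop w y ^ 2 * y)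
      (((IntegralLE.of_integrableOn hv').const_mul (c := 2) (by norm_num)).add
      ((IntegralLE.of_integrableOn hv).const_mul (c := 8) (by norm_num)))
      ((hHc.pow 2).mul continuousOn_id) (fun y hy => by positivity) fun y hy => ?_).1
    rw [hHv y hy, ← sub_nonneg]
    generalize deriv (Aop w) y = a
    generalize Aop w y = b
    have : 0 ≤ y * (a - 2 / (y * (1 + y ^ 2)) * b) ^ 2
        + 8 * b ^ 2 * y / (1 + y ^ 2) ^ 2 := by positivity
    convert this using 1
    field_simp
    ring
  refine IntegralLE.of_forall_pos fun δ hδ => ?_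
  refine IntegralLE.of_flux (IntegralLE.of_integrableOn hH)
    (F₀ := fun y => -(2 / (1 + y ^ 2) * Aop w y ^ 2))
    (F₁ := fun y => -(2 / (1 + y ^ 2) * Aop w y ^ 2))
    (fun y hy => by positivity) ?_ (fun y hy => by positivity) (fun y hy _ => ?_)
    (fun y hy => ?_) ?_ le_rfl (fun y _ => by rw [neg_nonpos]; positivity)
  · refine ((hv'c.pow 2).mul continuousOn_id).add (continuousOn_const.mul
      (((hvc.pow 2).div (by fun_prop) fun y hy => ?_).mul continuousOn_id))
    have : (0 : ℝ) < y := hy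
    positivity
  all_goals try
    have hy0 : 0 < y := by linarith
    have hd := (((hasDerivAt_const y (2 : ℝ)).div ((hasDerivAt_pow 2 y).const_add 1)
      (by positivity)).mul ((hvd y hy0).pow 2)).neg
    refine ⟨_, hd, le_of_eq ?_⟩
    rw [hHv y hy0]
    simp only [Pi.pow_apply, Pi.div_apply]
    field_simp
    push_cast
    ring
  refine ((frequently_mul_lt_of_integrableOn hv (half_pos hδ)).and_eventually
    self_mem_nhdsWithin).mono fun y ⟨hlt, hy⟩ => ?_
  have hy0 : (0 : ℝ) < y := hy
  have e : y * (Aop w y ^ 2 / (y ^ 2 * (1 + y ^ 2)) * y) = Aop w y ^ 2 / (1 + y ^ 2) := by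
    field_simp
  rw [e] at hlt
  rw [neg_le_neg_iff, div_mul_eq_mul_div, mul_div_assoc]
  linarith

/-- Weighted bound for `v` with the critical weight at infinity. -/
lemma integralLE_log {v : ℝ → ℝ} {B : ℝ} (hvd : ∀ y, 0 < y → HasDerivAt v (deriv v y) y)
    (hv : IntegralLE (fun y => deriv v y ^ 2 * y + 4 * (v y ^ 2 / (y ^ 2 * (1 + y ^ 2)) * y)) B) :
    IntegralLE (fun y => v y ^ 2 / (y * (1 + |log y|) ^ 2)) (4 * B) := by
  have hvc : ContinuousOn v (Ioi 0) := fun y hy => (hvd y hy).continuousAt.continuousWithinAt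
  refine add_zero (4 * B) ▸ IntegralLE.of_flux (hv.const_mul (c := 4) (by norm_num))
    (F₀ := fun _ => 0) (F₁ := fun x => 2 * (((x ^ 2)⁻¹ - 1) / (1 + log x) * v x ^ 2))
    (fun y hy => by positivity) ?_ (fun y hy => by positivity) (fun y hy hy1 => ?_)
    (fun y hy => ?_) (Frequently.of_forall fun _ => by simp) (by simp) (fun y hy => ?_)
  · refine (hvc.pow 2).div (continuousOn_id.mul (continuousOn_logWeight.pow 2)) fun y hy => ?_
    have : (0 : ℝ) < y := hy
    change y * (1 + |log y|) ^ 2 ≠ 0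
    positivity
  · refine ⟨0, hasDerivAt_const _ _, ?_⟩
    have h1 : v y ^ 2 / (y * (1 + |log y|) ^ 2) ≤ v y ^ 2 / y := by
      gcongr
      exact le_mul_of_one_le_right hy.le (one_le_pow₀ (by linarith [abs_nonneg (log y)]))
    have h2 : v y ^ 2 / y ≤ 2 * (v y ^ 2 / (y ^ 2 * (1 + y ^ 2)) * y) := by
      have e : 2 * (v y ^ 2 / (y ^ 2 * (1 + y ^ 2)) * y) = (2 * v y ^ 2) / (y * (1 + y ^ 2)) := by
        field_simp
      rw [e, div_le_div_iff₀ hy (by positivity)]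
      have : 1 + y ^ 2 ≤ 2 := by nlinarith
      nlinarith [mul_le_mul_of_nonneg_left this (by positivity : 0 ≤ v y ^ 2 * y)]
    have : 0 ≤ v y ^ 2 / (y ^ 2 * (1 + y ^ 2)) * y := by positivity
    have : 0 ≤ deriv v y ^ 2 * y := by positivity
    linarith
  · have hy0 : 0 < y := one_pos.trans_le hy
    obtain ⟨D, hD, h⟩ := hardy_log_near_infinity hy (hvd y hy0)
    refine ⟨D, hD, h.trans ?_⟩
    have h2 : v y ^ 2 / y ^ 3 ≤ 2 * (v y ^ 2 / (y ^ 2 * (1 + y ^ 2)) * y) := by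
      have e : 2 * (v y ^ 2 / (y ^ 2 * (1 + y ^ 2)) * y) = (2 * v y ^ 2) / (y * (1 + y ^ 2)) := by
        field_simp
      rw [e, div_le_div_iff₀ (by positivity) (by positivity)]
      have : 1 + y ^ 2 ≤ 2 * y ^ 2 := by nlinarith
      nlinarith [mul_le_mul_of_nonneg_left this (by positivity : 0 ≤ v y ^ 2 * y)]
    have : 0 ≤ v y ^ 2 / (y ^ 2 * (1 + y ^ 2)) * y := by positivity
    have e : 5 * v y ^ 2 / y ^ 3 = 5 * (v y ^ 2 / y ^ 3) := by ring
    linarith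
  · have hy0 : 0 < y := one_pos.trans_le hy
    have h1 : (y ^ 2)⁻¹ - 1 ≤ 0 := sub_nonpos.2 (inv_le_one_of_one_le₀ (one_le_pow₀ hy))
    have h2 : 0 ≤ 1 + log y := by linarith [log_nonneg hy]
    have : ((y ^ 2)⁻¹ - 1) / (1 + log y) * v y ^ 2 ≤ 0 :=
      mul_nonpos_of_nonpos_of_nonneg (div_nonpos_of_nonpos_of_nonneg h1 h2) (sq_nonneg _)
    linarith

/-- Bound for `w` in terms of `v = A w`. -/
lemma integralLE_of_Aop {w : ℝ → ℝ} {B b : ℝ} (hw : ContDiffOn ℝ 2 w (Ioi 0))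
    (hv : IntegralLE (fun y => deriv (Aop w) y ^ 2 * y
      + 4 * (Aop w y ^ 2 / (y ^ 2 * (1 + y ^ 2)) * y)) B)
    (hloc : IntegralLE (fun y => w y ^ 2 / (1 + y ^ 5) * y) b) :
    IntegralLE (fun y => w y ^ 2 / (y ^ 3 * (1 + |log y|) ^ 2)) (4 * B + 4 * B + 344 * b) := by
  have hw2 : ContDiffOn ℝ ((1 : ℕ) + 1) w (Ioi 0) := by convert hw using 1; norm_num
  have hlog := integralLE_log (fun y hy => (hasDerivAt_Aop hw hy).differentiableAt.hasDerivAt) hv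
  have hE := ((hv.const_mul (c := 4) (by norm_num)).add hlog).add
    (hloc.const_mul (c := 344) (by norm_num))
  refine integralLE_of_A (k := 2) le_rfl hE (fun y hy => by positivity) ?_
    (fun y hy => by positivity) (fun y hy => hasDerivAt_eq_Aop hw2 hy) (fun y _ _ => le_rfl)
    (fun y _ => le_rfl) (fun y hy0 hy1 => ?_) (fun y hy => ?_)
  · refine (hw.continuousOn.pow 2).div ((continuousOn_id.pow 3).mul (continuousOn_logWeight.pow 2))
      fun y hy => ?_
    have : (0 : ℝ) < y := hy
    change y ^ 3 * (1 + |log y|) ^ 2 ≠ 0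
    positivity
  · have h1 : 0 ≤ Aop w y ^ 2 / (y * (1 + |log y|) ^ 2) := by positivity
    have h2 : 0 ≤ deriv (Aop w) y ^ 2 * y := by positivity
    have h3 : Aop w y ^ 2 / y ≤ 2 * (Aop w y ^ 2 / (y ^ 2 * (1 + y ^ 2)) * y) := by
      have := div_mul_le_const_mul (c := 2) (sq_nonneg (Aop w y)) hy0
        (by positivity : 0 < y ^ 2 * (1 + y ^ 2)) (by positivity : 0 < y ^ 2)
        (by nlinarith [mul_le_mul_of_nonneg_left (pow_le_one₀ hy0.le hy1 (n := 2)) (sq_nonneg y)])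
      refine le_of_eq_of_le ?_ this
      field_simp
    have h4 : w y ^ 2 / 1 * y ≤ 2 * (w y ^ 2 / (1 + y ^ 5) * y) :=
      div_mul_le_const_mul (sq_nonneg _) hy0 (by positivity) one_pos
        (by linarith [pow_le_one₀ hy0.le hy1 (n := 5)])
    have e : 8 * Aop w y ^ 2 / y = 8 * (Aop w y ^ 2 / y) := by ring
    linarith
  · have hy0 : 0 < y := one_pos.trans_le hy
    have h1 : y * Aop w y ^ 2 / (y ^ 2 * (1 + |log y|) ^ 2) =
        Aop w y ^ 2 / (y * (1 + |log y|) ^ 2) := by field_simp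
    have h2 : 0 ≤ deriv (Aop w) y ^ 2 * y + 4 * (Aop w y ^ 2 / (y ^ 2 * (1 + y ^ 2)) * y) := by
      positivity
    have h3 : w y ^ 2 / y ^ 6 * y ≤ 2 * (w y ^ 2 / (1 + y ^ 5) * y) :=
      div_mul_le_const_mul (sq_nonneg _) hy0 (by positivity) (by positivity)
        (by nlinarith [one_le_pow₀ hy (n := 5), pow_succ y 5])
    have e : ((2 : ℕ) + 2 : ℝ) * w y ^ 2 / y ^ (2 + 3) = 4 * (w y ^ 2 / y ^ 6 * y) := by
      field_simp; norm_num; ring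
    have h4 : 0 ≤ w y ^ 2 / (1 + y ^ 5) * y := by positivity
    linarith

lemma continuousOn_sq_div_logWeight {f q : ℝ → ℝ} (hf : ContinuousOn f (Ioi 0))
    (hq : ContinuousOn q (Ioi 0)) (hq0 : ∀ y, 0 < y → 0 < q y) :
    ContinuousOn (fun y => f y ^ 2 / (q y * (1 + |log y|) ^ 2) * y) (Ioi 0) := by
  refine ((hf.pow 2).div (hq.mul (continuousOn_logWeight.pow 2)) fun y hy => ?_).mul continuousOn_id
  have := hq0 y hy
  change q y * (1 + |log y|) ^ 2 ≠ 0
  positivity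

/-- The second derivative in terms of `H u`, `A u` and `u`. -/
lemma deriv_deriv_eq (u : ℝ → ℝ) {y : ℝ} (hy : 0 < y) :
    deriv (deriv u) y
      = -Hop u y + Aop u y / y + (2 * y ^ 2 - 6) / (1 + y ^ 2) ^ 2 * u y := by
  simp only [Hop, Aop, Vfun, Zfun]
  field_simp
  ring

/-- The third derivative in terms of `(H u)'`, `H u`, `A u`, `u'` and `u`. -/
lemma deriv_deriv_deriv_eq {u : ℝ → ℝ} (hu : ContDiffOn ℝ 4 u (Ioi 0)) {y : ℝ} (hy : 0 < y) :
    deriv (deriv (deriv u)) y = -deriv (Hop u) y + Hop u y / y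
      - (1 + 2 / (1 + y ^ 2)) * (Aop u y / y ^ 2) + (2 * y ^ 2 - 6) / (1 + y ^ 2) ^ 2 * deriv u y
      + (28 * y - 4 * y ^ 3) / (1 + y ^ 2) ^ 3 * u y := by
  have hH := hasDerivAt_deriv_of_contDiffOn (n := 1)
    (contDiffOn_Hop (n := 2) (by convert hu using 1; norm_num)) hy
  have hu0 := hasDerivAt_deriv_of_contDiffOn (n := 3) (by convert hu using 1; norm_num) hy
  have hA := hasDerivAt_Aop (hu.of_le (by norm_num)) hy
  have hφ := (((hasDerivAt_pow 2 y).const_mul 2).sub_const 6).div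
    (((hasDerivAt_pow 2 y).const_add 1).pow 2) (by simp only [Pi.pow_apply]; positivity)
  have hd := (hH.neg.add (hA.div (hasDerivAt_id y) hy.ne')).add (hφ.mul hu0)
  have heq : deriv (deriv u) =ᶠ[𝓝 y]
      fun y => -Hop u y + Aop u y / y + (2 * y ^ 2 - 6) / (1 + y ^ 2) ^ 2 * u y :=
    (eventually_gt_nhds hy).mono fun x hx => deriv_deriv_eq u hx
  refine (heq.hasDerivAt_iff.2 (HasDerivAt.congr_deriv (f := fun y => -Hop u y + Aop u y / y
    + (2 * y ^ 2 - 6) / (1 + y ^ 2) ^ 2 * u y) hd ?_)).deriv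
  simp only [Pi.pow_apply, Pi.div_apply, id]
  field_simp
  push_cast
  ring

/-- Bound for `w'` in terms of `w` and `v = A w`. -/
lemma integralLE_deriv_of_Aop {w : ℝ → ℝ} {B₁ B₂ : ℝ} (hw' : ContinuousOn (deriv w) (Ioi 0))
    (hW : IntegralLE (fun y => w y ^ 2 / (y ^ 3 * (1 + |log y|) ^ 2)) B₁)
    (hv : IntegralLE (fun y => Aop w y ^ 2 / (y * (1 + |log y|) ^ 2)) B₂) :
    IntegralLE (fun y => deriv w y ^ 2 / (y ^ 2 * (1 + |log y|) ^ 2) * y) (2 * B₁ + 2 * B₂) := by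
  refine ((hW.const_mul (c := 2) (by norm_num)).add (hv.const_mul (c := 2) (by norm_num))).mono
    (continuousOn_sq_div_logWeight hw' (by fun_prop) fun y hy => by positivity)
    (fun y hy => by positivity) fun y hy => ?_
  have hZ := Zfun_sq_le_one y
  have e : deriv w y = Zfun y * (w y / y) - Aop w y := by rw [Aop]; ring
  have key : deriv w y ^ 2 ≤ 2 * (w y / y) ^ 2 + 2 * Aop w y ^ 2 := by
    rw [e]
    nlinarith [sq_nonneg (Zfun y * (w y / y) + Aop w y),
      mul_le_mul_of_nonneg_right hZ (sq_nonneg (w y / y))]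
  calc deriv w y ^ 2 / (y ^ 2 * (1 + |log y|) ^ 2) * y
      = 1 / (y * (1 + |log y|) ^ 2) * deriv w y ^ 2 := by field_simp
    _ ≤ 1 / (y * (1 + |log y|) ^ 2) * (2 * (w y / y) ^ 2 + 2 * Aop w y ^ 2) := by gcongr
    _ = _ := by field_simp

/-- Bound for `A u` in terms of `H u`. -/
lemma integralLE_Aop_of_Hop {u : ℝ → ℝ} {B : ℝ} (hu : ContDiffOn ℝ 2 u (Ioi 0))
    (hW : IntegralLE (fun y => Hop u y ^ 2 / (y ^ 3 * (1 + |log y|) ^ 2)) B)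
    (hu₀ : IntegrableOn
      (fun y => u y ^ 2 / (y ^ 4 * (1 + y ^ 4) * (1 + |log y|) ^ 2) * y) (Ioi 0))
    (hu₁ : IntegrableOn
      (fun y => deriv u y ^ 2 / (y ^ 2 * (1 + y ^ 4) * (1 + |log y|) ^ 2) * y) (Ioi 0)) :
    IntegralLE (fun y => Aop u y ^ 2 / (y ^ 5 * (1 + |log y|) ^ 2)) (B + 4 * B) := by
  refine integralLE_of_adjoint hW (fun y hy => hasDerivAt_Aop hu hy)
    ((hu₀.add hu₁).const_mul 2) fun y hy => ?_
  have hZ := Zfun_sq_le_one y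
  have e : Aop u y = Zfun y * (u y / y) - deriv u y := by rw [Aop]; ring
  have key : Aop u y ^ 2 ≤ 2 * (u y / y) ^ 2 + 2 * deriv u y ^ 2 := by
    rw [e]
    nlinarith [sq_nonneg (Zfun y * (u y / y) + deriv u y),
      mul_le_mul_of_nonneg_right hZ (sq_nonneg (u y / y))]
  calc Aop u y ^ 2 / ((1 + y ^ 4) * (1 + |log y|) ^ 2)
      ≤ (2 * (u y / y) ^ 2 + 2 * deriv u y ^ 2) / ((1 + y ^ 4) * (1 + |log y|) ^ 2) := by gcongr
    _ = _ := by
      simp only [Pi.add_apply]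
      field_simp

/-- Bound for `u` in terms of `A u`. -/
lemma integralLE_of_Aop_weighted {u : ℝ → ℝ} {B b : ℝ} (hu : ContDiffOn ℝ 2 u (Ioi 0))
    (hP : IntegralLE (fun y => Aop u y ^ 2 / (y ^ 5 * (1 + |log y|) ^ 2)) B)
    (hloc : IntegralLE (fun y => u y ^ 2 / (1 + y ^ 10) * y) b) :
    IntegralLE (fun y => u y ^ 2 / (y ^ 4 * (1 + y ^ 4) * (1 + |log y|) ^ 2) * y)
      (8 * B + 344 * b) := by
  refine integralLE_of_A (k := 6) (by norm_num)
    ((hP.const_mul (c := 8) (by norm_num)).add (hloc.const_mul (c := 344) (by norm_num)))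
    (fun y hy => by positivity)
    (continuousOn_sq_div_logWeight hu.continuousOn (by fun_prop) fun y hy => by positivity)
    (fun y hy => by positivity)
    (fun y hy => hasDerivAt_eq_Aop (n := 1) (by convert hu using 1; norm_num) hy)
    (fun y hy _ => ?_) (fun y hy => ?_) (fun y hy0 hy1 => ?_) (fun y hy => ?_)
  · calc _ = u y ^ 2 / (y ^ 3 * (1 + |log y|) ^ 2) / (1 + y ^ 4) := by field_simp
      _ ≤ _ := div_le_self (by positivity) (by nlinarith [pow_pos hy 4])
  · have hy0 : 0 < y := one_pos.trans_le hy
    calc u y ^ 2 / (y ^ 4 * (1 + y ^ 4) * (1 + |log y|) ^ 2) * y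
        = u y ^ 2 / (y ^ 3 * (1 + y ^ 4) * (1 + |log y|) ^ 2) := by field_simp
      _ ≤ u y ^ 2 / (y ^ 3 * y ^ 4 * (1 + |log y|) ^ 2) := by
        gcongr
        linarith
      _ = _ := by ring_nf
  · have h1 : Aop u y ^ 2 / y ≤ Aop u y ^ 2 / (y ^ 5 * (1 + |log y|) ^ 2) := by
      gcongr
      have : y ^ 2 * (y * (1 + |log y|)) ^ 2 ≤ 1 :=
        mul_le_one₀ (pow_le_one₀ hy0.le hy1) (by positivity)
          (pow_le_one₀ (by positivity) (mul_logWeight_le_one hy0 hy1))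
      calc y ^ 5 * (1 + |log y|) ^ 2 = y * (y ^ 2 * (y * (1 + |log y|)) ^ 2) := by ring
        _ ≤ y * 1 := by gcongr
        _ = y := mul_one y
    have h2 : u y ^ 2 / 1 * y ≤ 2 * (u y ^ 2 / (1 + y ^ 10) * y) :=
      div_mul_le_const_mul (sq_nonneg _) hy0 (by positivity) one_pos
        (by linarith [pow_le_one₀ hy0.le hy1 (n := 10)])
    have e : 8 * Aop u y ^ 2 / y = 8 * (Aop u y ^ 2 / y) := by ring
    linarith
  · have hy0 : 0 < y := one_pos.trans_le hy
    have h1 : y * Aop u y ^ 2 / (y ^ 6 * (1 + |log y|) ^ 2) =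
        Aop u y ^ 2 / (y ^ 5 * (1 + |log y|) ^ 2) := by field_simp
    have h2 : 0 ≤ Aop u y ^ 2 / (y ^ 5 * (1 + |log y|) ^ 2) := by positivity
    have h3 : u y ^ 2 / y ^ 10 * y ≤ 2 * (u y ^ 2 / (1 + y ^ 10) * y) :=
      div_mul_le_const_mul (sq_nonneg _) hy0 (by positivity) (by positivity)
        (by linarith [one_le_pow₀ hy (n := 10)])
    have e : ((6 : ℕ) + 2 : ℝ) * u y ^ 2 / y ^ (6 + 3) = 8 * (u y ^ 2 / y ^ 10 * y) := by
      field_simp; norm_num; ring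
    have h4 : 0 ≤ u y ^ 2 / (1 + y ^ 10) * y := by positivity
    linarith

/-- Bound for `u'` in terms of `u` and `A u`. -/
lemma integralLE_deriv_of_Aop_weighted {u : ℝ → ℝ} {B₁ B₂ : ℝ}
    (hu' : ContinuousOn (deriv u) (Ioi 0))
    (hU : IntegralLE (fun y => u y ^ 2 / (y ^ 4 * (1 + y ^ 4) * (1 + |log y|) ^ 2) * y) B₁)
    (hP : IntegralLE (fun y => Aop u y ^ 2 / (y ^ 5 * (1 + |log y|) ^ 2)) B₂) :
    IntegralLE (fun y => deriv u y ^ 2 / (y ^ 2 * (1 + y ^ 4) * (1 + |log y|) ^ 2) * y)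
      (2 * B₁ + 2 * B₂) := by
  refine ((hU.const_mul (c := 2) (by norm_num)).add (hP.const_mul (c := 2) (by norm_num))).mono
    (continuousOn_sq_div_logWeight hu' (by fun_prop) fun y hy => by positivity)
    (fun y hy => by positivity) fun y hy => ?_
  have hZ := Zfun_sq_le_one y
  have e : deriv u y = Zfun y * (u y / y) - Aop u y := by rw [Aop]; ring
  have key : deriv u y ^ 2 ≤ 2 * (u y / y) ^ 2 + 2 * Aop u y ^ 2 := by
    rw [e]
    nlinarith [sq_nonneg (Zfun y * (u y / y) + Aop u y),
      mul_le_mul_of_nonneg_right hZ (sq_nonneg (u y / y))]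
  calc deriv u y ^ 2 / (y ^ 2 * (1 + y ^ 4) * (1 + |log y|) ^ 2) * y
      = deriv u y ^ 2 / (y * (1 + y ^ 4) * (1 + |log y|) ^ 2) := by field_simp
    _ ≤ (2 * (u y / y) ^ 2 + 2 * Aop u y ^ 2) / (y * (1 + y ^ 4) * (1 + |log y|) ^ 2) := by gcongr
    _ = 2 * (u y ^ 2 / (y ^ 4 * (1 + y ^ 4) * (1 + |log y|) ^ 2) * y)
        + 2 * (Aop u y ^ 2 / (y * (1 + y ^ 4) * (1 + |log y|) ^ 2)) := by field_simp
    _ ≤ _ := by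
      gcongr 2 * _ + 2 * (_ / (?_ * _))
      nlinarith [mul_pos hy (pow_pos hy 4)]

lemma deriv_deriv_coeff_sq_le (y : ℝ) :
    ((2 * y ^ 2 - 6) / (1 + y ^ 2) ^ 2) ^ 2 ≤ 36 / (1 + y ^ 4) := by
  rw [div_pow, div_le_div_iff₀ (by positivity) (by positivity), ← sub_nonneg]
  have : 0 ≤ 168 * y ^ 2 + 176 * y ^ 4 + 168 * y ^ 6 + 32 * y ^ 8 := by positivity
  refine this.trans (le_of_eq ?_)
  ring

lemma deriv_deriv_deriv_coeff_sq_le {y : ℝ} (hy : 0 < y) :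
    ((28 * y - 4 * y ^ 3) / (1 + y ^ 2) ^ 3) ^ 2 ≤ 784 / (y ^ 2 * (1 + y ^ 4)) := by
  rw [div_pow, div_le_div_iff₀ (by positivity) (by positivity), ← sub_nonneg]
  have : 0 ≤ 784 + 4704 * y ^ 2 + 10976 * y ^ 4 + 15904 * y ^ 6 + 10960 * y ^ 8
      + 4928 * y ^ 10 + 768 * y ^ 12 := by positivity
  refine this.trans (le_of_eq ?_)
  ring

/-- Bound for `u''` in terms of `H u`, `A u` and `u`. -/
lemma integralLE_deriv_deriv {u : ℝ → ℝ} {B₁ B₂ B₃ : ℝ}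
    (hu'' : ContinuousOn (deriv (deriv u)) (Ioi 0))
    (hW : IntegralLE (fun y => Hop u y ^ 2 / (y ^ 3 * (1 + |log y|) ^ 2)) B₁)
    (hP : IntegralLE (fun y => Aop u y ^ 2 / (y ^ 5 * (1 + |log y|) ^ 2)) B₂)
    (hU : IntegralLE (fun y => u y ^ 2 / (y ^ 4 * (1 + y ^ 4) * (1 + |log y|) ^ 2) * y) B₃) :
    IntegralLE (fun y => deriv (deriv u) y ^ 2 / (y ^ 4 * (1 + |log y|) ^ 2) * y)
      (3 * B₁ + 3 * B₂ + 108 * B₃) := by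
  refine (((hW.const_mul (c := 3) (by norm_num)).add (hP.const_mul (c := 3) (by norm_num))).add
    (hU.const_mul (c := 108) (by norm_num))).mono
    (continuousOn_sq_div_logWeight hu'' (by fun_prop) fun y hy => by positivity)
    (fun y hy => by positivity) fun y hy => ?_
  have hφ := mul_le_mul_of_nonneg_right (deriv_deriv_coeff_sq_le y) (sq_nonneg (u y))
  have key : deriv (deriv u) y ^ 2 ≤
      3 * Hop u y ^ 2 + 3 * (Aop u y / y) ^ 2 + 3 * (36 / (1 + y ^ 4) * u y ^ 2) := by
    rw [deriv_deriv_eq u hy]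
    rw [← mul_pow] at hφ
    generalize (2 * y ^ 2 - 6) / (1 + y ^ 2) ^ 2 * u y = c at *
    generalize Aop u y / y = b
    generalize Hop u y = a
    nlinarith [sq_nonneg (a + b), sq_nonneg (a + c), sq_nonneg (b - c)]
  calc deriv (deriv u) y ^ 2 / (y ^ 4 * (1 + |log y|) ^ 2) * y
      = 1 / (y ^ 3 * (1 + |log y|) ^ 2) * deriv (deriv u) y ^ 2 := by field_simp
    _ ≤ 1 / (y ^ 3 * (1 + |log y|) ^ 2) *
        (3 * Hop u y ^ 2 + 3 * (Aop u y / y) ^ 2 + 3 * (36 / (1 + y ^ 4) * u y ^ 2)) := by gcongr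
    _ = _ := by field_simp; ring

/-- Bound for `u'''` in terms of `(H u)'`, `H u`, `A u`, `u'` and `u`. -/
lemma integralLE_deriv_deriv_deriv {u : ℝ → ℝ} {B₀ B₁ B₂ B₃ B₄ : ℝ}
    (hu : ContDiffOn ℝ 4 u (Ioi 0)) (hu''' : ContinuousOn (deriv (deriv (deriv u))) (Ioi 0))
    (hW' : IntegralLE (fun y => deriv (Hop u) y ^ 2 / (y ^ 2 * (1 + |log y|) ^ 2) * y) B₀)
    (hW : IntegralLE (fun y => Hop u y ^ 2 / (y ^ 3 * (1 + |log y|) ^ 2)) B₁)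
    (hP : IntegralLE (fun y => Aop u y ^ 2 / (y ^ 5 * (1 + |log y|) ^ 2)) B₂)
    (hU' : IntegralLE
      (fun y => deriv u y ^ 2 / (y ^ 2 * (1 + y ^ 4) * (1 + |log y|) ^ 2) * y) B₃)
    (hU : IntegralLE (fun y => u y ^ 2 / (y ^ 4 * (1 + y ^ 4) * (1 + |log y|) ^ 2) * y) B₄) :
    IntegralLE (fun y => deriv (deriv (deriv u)) y ^ 2 / (y ^ 2 * (1 + |log y|) ^ 2) * y)
      (5 * B₀ + 5 * B₁ + 45 * B₂ + 180 * B₃ + 3920 * B₄) := by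
  refine (((((hW'.const_mul (c := 5) (by norm_num)).add (hW.const_mul (c := 5) (by norm_num))).add
    (hP.const_mul (c := 45) (by norm_num))).add (hU'.const_mul (c := 180) (by norm_num))).add
    (hU.const_mul (c := 3920) (by norm_num))).mono
    (continuousOn_sq_div_logWeight hu''' (by fun_prop) fun y hy => by positivity)
    (fun y hy => by positivity) fun y hy => ?_
  have hφ := mul_le_mul_of_nonneg_right (deriv_deriv_coeff_sq_le y) (sq_nonneg (deriv u y))
  have hψ := mul_le_mul_of_nonneg_right (deriv_deriv_deriv_coeff_sq_le hy) (sq_nonneg (u y))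
  have hχ : ((1 + 2 / (1 + y ^ 2)) * (Aop u y / y ^ 2)) ^ 2 ≤ 9 * (Aop u y / y ^ 2) ^ 2 := by
    rw [mul_pow]
    gcongr
    have h1 : 2 / (1 + y ^ 2) ≤ 2 := div_le_self (by norm_num) (by nlinarith [sq_nonneg y])
    have h2 : 0 ≤ 2 / (1 + y ^ 2) := by positivity
    nlinarith
  have key : deriv (deriv (deriv u)) y ^ 2 ≤
      5 * deriv (Hop u) y ^ 2 + 5 * (Hop u y / y) ^ 2 + 5 * (9 * (Aop u y / y ^ 2) ^ 2)
        + 5 * (36 / (1 + y ^ 4) * deriv u y ^ 2) + 5 * (784 / (y ^ 2 * (1 + y ^ 4)) * u y ^ 2) := by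
    rw [deriv_deriv_deriv_eq hu hy]
    rw [← mul_pow] at hφ hψ
    generalize (2 * y ^ 2 - 6) / (1 + y ^ 2) ^ 2 * deriv u y = d at *
    generalize (28 * y - 4 * y ^ 3) / (1 + y ^ 2) ^ 3 * u y = e at *
    generalize (1 + 2 / (1 + y ^ 2)) * (Aop u y / y ^ 2) = c at *
    generalize Hop u y / y = b
    generalize deriv (Hop u) y = a
    nlinarith [sq_nonneg (a + b), sq_nonneg (a - c), sq_nonneg (a + d), sq_nonneg (a + e),
      sq_nonneg (b + c), sq_nonneg (b - d), sq_nonneg (b - e), sq_nonneg (c + d),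
      sq_nonneg (c + e), sq_nonneg (d - e)]
  calc deriv (deriv (deriv u)) y ^ 2 / (y ^ 2 * (1 + |log y|) ^ 2) * y
      = 1 / (y * (1 + |log y|) ^ 2) * deriv (deriv (deriv u)) y ^ 2 := by field_simp
    _ ≤ 1 / (y * (1 + |log y|) ^ 2) * (5 * deriv (Hop u) y ^ 2 + 5 * (Hop u y / y) ^ 2
        + 5 * (9 * (Aop u y / y ^ 2) ^ 2) + 5 * (36 / (1 + y ^ 4) * deriv u y ^ 2)
        + 5 * (784 / (y ^ 2 * (1 + y ^ 4)) * u y ^ 2)) := by gcongr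
    _ = _ := by field_simp; ring

/-- Sub-coercivity for `H²`: there exist universal `c, C > 0` such that for every
`u ∈ C⁴((0,∞))` with the stated finiteness assumptions,
`∫ (H²u)² ≥ c [∫ (Hu)²/(y⁴(1+|log y|)²) + ∫ ((Hu)')²/(y²(1+|log y|)²)
    + ∫ (u''')²/(y²(1+|log y|)²) + ∫ (u'')²/(y⁴(1+|log y|)²)
    + ∫ (u')²/(y²(1+y⁴)(1+|log y|)²) + ∫ u²/(y⁴(1+y⁴)(1+|log y|)²)]
  − C [∫ (Hu)²/(1+y⁵) + ∫ (u')²/(1+y⁸) + ∫ u²/(1+y¹⁰)]` (w.r.t. `y dy`). -/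
theorem subcoercivity_H_squared :
    ∃ c C : ℝ, 0 < c ∧ 0 < C ∧
      ∀ u : ℝ → ℝ, ContDiffOn ℝ 4 u (Set.Ioi 0) →
        IntegrableOn (fun y => (deriv (Aop (Hop u)) y) ^ 2 * y) (Set.Ioi 0) →
        IntegrableOn (fun y => (Aop (Hop u) y) ^ 2 / (y ^ 2 * (1 + y ^ 2)) * y)
          (Set.Ioi 0) →
        IntegrableOn (fun y => (Hop u y) ^ 2 / (y ^ 4 * (1 + |Real.log y|) ^ 2) * y)
          (Set.Ioi 0) →
        IntegrableOn
          (fun y => (u y) ^ 2 / (y ^ 4 * (1 + y ^ 4) * (1 + |Real.log y|) ^ 2) * y)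
          (Set.Ioi 0) →
        IntegrableOn
          (fun y => (deriv u y) ^ 2 / (y ^ 2 * (1 + y ^ 4) * (1 + |Real.log y|) ^ 2) * y)
          (Set.Ioi 0) →
        (∫ y in Set.Ioi (0:ℝ), (Hop (Hop u) y) ^ 2 * y)
          ≥ c * ((∫ y in Set.Ioi (0:ℝ),
                  (Hop u y) ^ 2 / (y ^ 4 * (1 + |Real.log y|) ^ 2) * y)
              + (∫ y in Set.Ioi (0:ℝ),
                  (deriv (Hop u) y) ^ 2 / (y ^ 2 * (1 + |Real.log y|) ^ 2) * y)
              + (∫ y in Set.Ioi (0:ℝ),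
                  (deriv (deriv (deriv u)) y) ^ 2 / (y ^ 2 * (1 + |Real.log y|) ^ 2) * y)
              + (∫ y in Set.Ioi (0:ℝ),
                  (deriv (deriv u) y) ^ 2 / (y ^ 4 * (1 + |Real.log y|) ^ 2) * y)
              + (∫ y in Set.Ioi (0:ℝ),
                  (deriv u y) ^ 2 / (y ^ 2 * (1 + y ^ 4) * (1 + |Real.log y|) ^ 2) * y)
              + ∫ y in Set.Ioi (0:ℝ),
                  (u y) ^ 2 / (y ^ 4 * (1 + y ^ 4) * (1 + |Real.log y|) ^ 2) * y)
            - C * ((∫ y in Set.Ioi (0:ℝ), (Hop u y) ^ 2 / (1 + y ^ 5) * y)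
              + (∫ y in Set.Ioi (0:ℝ), (deriv u y) ^ 2 / (1 + y ^ 8) * y)
              + ∫ y in Set.Ioi (0:ℝ), (u y) ^ 2 / (1 + y ^ 10) * y) := by
  refine ⟨1 / 10 ^ 9, 1, by norm_num, one_pos, fun u hu hv' hv hw hu₀ hu₁ => ?_⟩
  have hu2 : ContDiffOn ℝ 2 u (Ioi 0) := hu.of_le (by norm_num)
  have hw2 : ContDiffOn ℝ 2 (Hop u) (Ioi 0) :=
    contDiffOn_Hop (n := 2) (by convert hu using 1; norm_num)
  have hw' : ContDiffOn ℝ (1 : ℕ) (deriv (Hop u)) (Ioi 0) :=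
    contDiffOn_deriv (by convert hw2 using 1; norm_num)
  have hu' : ContDiffOn ℝ (3 : ℕ) (deriv u) (Ioi 0) :=
    contDiffOn_deriv (by convert hu using 1; norm_num)
  have hu'' : ContDiffOn ℝ (2 : ℕ) (deriv (deriv u)) (Ioi 0) :=
    contDiffOn_deriv (by convert hu' using 1; norm_num)
  have hu''' : ContDiffOn ℝ (1 : ℕ) (deriv (deriv (deriv u))) (Ioi 0) :=
    contDiffOn_deriv (by convert hu'' using 1; norm_num)
  have hlocw : IntegrableOn (fun y => Hop u y ^ 2 / (1 + y ^ 5) * y) (Ioi 0) :=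
    (((IntegralLE.of_integrableOn hw).const_mul (c := 4) (by norm_num)).mono
      (G := fun y => Hop u y ^ 2 / (1 + y ^ 5) * y)
      (((hw2.continuousOn.pow 2).div (by fun_prop) fun y (hy : 0 < y) => by positivity).mul
        continuousOn_id) (fun y hy => by positivity) fun y hy =>
      div_mul_le_const_mul (sq_nonneg _) hy (by positivity) (by positivity)
        (pow_mul_logWeight_sq_le hy 2)).1
  have hlocu : IntegrableOn (fun y => u y ^ 2 / (1 + y ^ 10) * y) (Ioi 0) :=
    (((IntegralLE.of_integrableOn hu₀).const_mul (c := 16) (by norm_num)).mono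
      (G := fun y => u y ^ 2 / (1 + y ^ 10) * y)
      (((hu.continuousOn.pow 2).div (by fun_prop) fun y (hy : 0 < y) => by positivity).mul
        continuousOn_id) (fun y hy => by positivity) fun y hy =>
      div_mul_le_const_mul (sq_nonneg _) hy (by positivity) (by positivity) (by
        have h1 := pow_mul_logWeight_sq_le hy 2
        have h2 := pow_mul_logWeight_sq_le hy 6
        have h3 : y ^ 5 ≤ 1 + y ^ 10 := by nlinarith [sq_nonneg (y ^ 5 - 1)]
        have h4 : y ^ 9 ≤ 1 + y ^ 10 := by
          rcases le_total y 1 with h | h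
          · nlinarith [pow_le_one₀ hy.le h (n := 9), pow_pos hy 10]
          · nlinarith [pow_le_pow_right₀ h (by norm_num : 9 ≤ 10)]
        have e : y ^ 4 * (1 + y ^ 4) * (1 + |log y|) ^ 2 =
          y ^ (2 + 2) * (1 + |log y|) ^ 2 + y ^ (6 + 2) * (1 + |log y|) ^ 2 := by ring
        norm_num at h1 h2 e
        linarith [pow_pos hy 10])).1
  have hE := integralLE_energy hw2 hv' hv
  have hW := integralLE_of_Aop hw2 hE (IntegralLE.of_integrableOn hlocw)
  have hV := integralLE_log
    (fun y hy => (hasDerivAt_Aop hw2 hy).differentiableAt.hasDerivAt) hE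
  have hW' := integralLE_deriv_of_Aop hw'.continuousOn hW hV
  have hP := integralLE_Aop_of_Hop hu2 hW hu₀ hu₁
  have hU := integralLE_of_Aop_weighted hu2 hP (IntegralLE.of_integrableOn hlocu)
  have hU' := integralLE_deriv_of_Aop_weighted hu'.continuousOn hU hP
  have hU'' := integralLE_deriv_deriv hu''.continuousOn hW hP hU
  have hU''' := integralLE_deriv_deriv_deriv hu hu'''.continuousOn hW' hW hP hU' hU
  have hw₀ := hW.mono (G := fun y => Hop u y ^ 2 / (y ^ 4 * (1 + |log y|) ^ 2) * y)
    (continuousOn_sq_div_logWeight hw2.continuousOn (by fun_prop) fun y hy => by positivity)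
    (fun y hy => by positivity) fun y hy => le_of_eq (by field_simp)
  have hD : 0 ≤ ∫ y in Ioi (0 : ℝ), Hop (Hop u) y ^ 2 * y :=
    setIntegral_nonneg measurableSet_Ioi fun y (hy : 0 < y) => by positivity
  have hl₀ : 0 ≤ ∫ y in Ioi (0 : ℝ), Hop u y ^ 2 / (1 + y ^ 5) * y :=
    setIntegral_nonneg measurableSet_Ioi fun y (hy : 0 < y) => by positivity
  have hl₁ : 0 ≤ ∫ y in Ioi (0 : ℝ), deriv u y ^ 2 / (1 + y ^ 8) * y :=
    setIntegral_nonneg measurableSet_Ioi fun y (hy : 0 < y) => by positivity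
  have hl₂ : 0 ≤ ∫ y in Ioi (0 : ℝ), u y ^ 2 / (1 + y ^ 10) * y :=
    setIntegral_nonneg measurableSet_Ioi fun y (hy : 0 < y) => by positivity
  have h₀ := hw₀.2
  have h₁ := hW'.2
  have h₂ := hU'''.2
  have h₃ := hU''.2
  have h₄ := hU'.2
  have h₅ := hU.2
  linarith
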